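/- Let P = (X, d, x̄) be a presentation of a Polish space X and let F ⊆ X be closed. Then π_P([D_P^{|A_F^P|_P}(A_F^P)]_P) equals the perfect kernel of F, i.e. the largest perfect subset of F. In particular, F is countable if and only if [D_P^{|A_F^P|_P}(A_F^P)]_P = ∅. -/

import Mathlib

open Set Filter Topology

/-- A presentation `(X, d, x̄)` of a Polish space `X`: a complete metric `d`
compatible with the topology of `X`, together with a dense sequence `x̄`. -/
structure Presentation (X : Type) [TopologicalSpace X] where
  dist : X → X → ℝ
  seq : ℕ → X
  dist_self : ∀ x, dist x x = 0
  eq_of_dist_eq_zero : ∀ x y, dist x y = 0 → x = y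
  dist_comm : ∀ x y, dist x y = dist y x
  dist_triangle : ∀ x y z, dist x z ≤ dist x y + dist y z
  /-- `d` is compatible with the topology of `X`. -/
  isOpen_iff : ∀ s : Set X, IsOpen s ↔ ∀ x ∈ s, ∃ ε > 0, ∀ y, dist y x < ε → y ∈ s
  /-- `d` is complete. -/
  complete : ∀ u : ℕ → X, (∀ ε > 0, ∃ N, ∀ m ≥ N, ∀ n ≥ N, dist (u m) (u n) < ε) →
      ∃ x, ∀ ε > 0, ∃ N, ∀ n ≥ N, dist (u n) x < ε
  /-- the sequence `x̄` is dense. -/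
  dense : ∀ x, ∀ ε > 0, ∃ i, dist x (seq i) < ε

namespace Presentation

variable {X : Type} [TopologicalSpace X] (P : Presentation X)

/-- The open ball `B_P(n)`. -/
def ball (n : ℕ × ℕ) : Set X := {x | P.dist x (P.seq n.1) < (1/2 : ℝ) ^ (n.2 + 1)}

/-- The closed ball `B̄_P(n)`. -/
def cball (n : ℕ × ℕ) : Set X := {x | P.dist x (P.seq n.1) ≤ (1/2 : ℝ) ^ (n.2 + 1)}

/-- The relation `n ≺_P m`. -/
def prec (n m : ℕ × ℕ) : Prop := n.2 < m.2 ∧ P.cball m ⊆ P.ball n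

/-- The relation `n ⋏_P m`. -/
def apart (n m : ℕ × ℕ) : Prop := P.cball n ∩ P.cball m = ∅

/-- The code `A_F^P` of a closed set `F ⊆ X`. -/
def code (F : Set X) : Set (ℕ × ℕ) := {n | (P.ball n ∩ F).Nonempty}

/-- The derivative `D_P` on subsets of `ω × ω`. -/
def deriv (A : Set (ℕ × ℕ)) : Set (ℕ × ℕ) :=
  {n ∈ A | ∃ u ∈ A, ∃ v ∈ A, P.prec n u ∧ P.prec n v ∧ P.apart u v}

/-- The transfinite iterates `D_P^α(A)`. -/
noncomputable def derivIter (A : Set (ℕ × ℕ)) (α : Ordinal.{0}) : Set (ℕ × ℕ) :=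
  Ordinal.limitRecOn α A (fun _ ih => P.deriv ih)
    (fun o _ ih => ⋂ (β : {β : Ordinal.{0} // β < o}), ih β.1 β.2)

/-- The rank `|A|_P`: the least ordinal `α` with `D_P^α(A) = D_P^{α+1}(A)`. -/
noncomputable def rankA (A : Set (ℕ × ℕ)) : Ordinal.{0} :=
  sInf {α | P.derivIter A (α + 1) = P.derivIter A α}

/-- The rank `φ_P(F) = |A_F^P|_P` of a (countable closed) subset `F ⊆ X`. -/
noncomputable def phi (F : Set X) : Ordinal.{0} := P.rankA (P.code F)

/-- `A ⊆ ω × ω` is `P`-closed. -/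
def PClosed (A : Set (ℕ × ℕ)) : Prop := ∀ n ∈ A, ∀ m, P.prec m n → m ∈ A

/-- `A ⊆ ω × ω` is `P`-pruned. -/
def PPruned (A : Set (ℕ × ℕ)) : Prop := ∀ n ∈ A, ∃ m ∈ A, P.prec n m

/-- `A ⊆ ω × ω` is `P`-perfect. -/
def PPerfect (A : Set (ℕ × ℕ)) : Prop :=
  ∀ n ∈ A, ∃ u ∈ A, ∃ v ∈ A, P.prec n u ∧ P.prec n v ∧ P.apart u v

/-- The set `[A]_P` of `P`-compatible sequences lying in `A`. -/
def body (A : Set (ℕ × ℕ)) : Set (ℕ → ℕ × ℕ) :=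
  {f | (∀ i, P.prec (f i) (f (i + 1))) ∧ ∀ i, f i ∈ A}

/-- The set `F_A^P = π_P([A]_P)`: the points obtained as the unique point of
`⋂_i B_P(n_i)` for a `P`-compatible sequence `(n_i)` in `A`. -/
def limitSet (A : Set (ℕ × ℕ)) : Set X :=
  {x | ∃ f ∈ P.body A, ∀ i, x ∈ P.ball (f i)}

end Presentation

section CB

variable {X : Type} [TopologicalSpace X]

/-- The Cantor–Bendixson derivative: the set of limit points of `F` in `F`. -/
def cbDeriv (F : Set X) : Set X := {x ∈ F | AccPt x (𝓟 F)}

/-- The iterated Cantor–Bendixson derivatives `F^α`. -/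
noncomputable def cbIter (F : Set X) (α : Ordinal.{0}) : Set X :=
  Ordinal.limitRecOn α F (fun _ ih => cbDeriv ih)
    (fun o _ ih => ⋂ (β : {β : Ordinal.{0} // β < o}), ih β.1 β.2)

/-- The Cantor–Bendixson rank `|F|_CB`. -/
noncomputable def cbRank (F : Set X) : Ordinal.{0} :=
  sInf {α | cbIter F (α + 1) = cbIter F α}

/-- The `K_σ`-derivative of a subset `A ⊆ X`: the points of `A` having no open
neighborhood in the subspace `A` whose closure in `A` is compact. -/
def kDeriv (A : Set X) : Set X :=
  {x ∈ A | ∀ U : Set X, IsOpen U → x ∈ U → ¬ IsCompact (A ∩ closure (U ∩ A))}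

/-- The iterated `K_σ`-derivatives `X_α` of the space `X`. -/
noncomputable def kIter (X : Type) [TopologicalSpace X] (α : Ordinal.{0}) : Set X :=
  Ordinal.limitRecOn α Set.univ (fun _ ih => kDeriv ih)
    (fun o _ ih => ⋂ (β : {β : Ordinal.{0} // β < o}), ih β.1 β.2)

/-- The `K_σ`-rank `|X|_{K_σ}`. -/
noncomputable def kRank (X : Type) [TopologicalSpace X] : Ordinal.{0} :=
  sInf {α | kIter X (α + 1) = kIter X α}

end CB

namespace Presentation

variable {X : Type} [TopologicalSpace X] (P : Presentation X)

lemma dist_nonneg (x y : X) : 0 ≤ P.dist x y := by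
  have h := P.dist_triangle x y x
  rw [P.dist_self, P.dist_comm y x] at h
  linarith

lemma isOpen_ball (n : ℕ × ℕ) : IsOpen (P.ball n) := by
  rw [P.isOpen_iff]
  intro x hx
  refine ⟨(1/2 : ℝ) ^ (n.2 + 1) - P.dist x (P.seq n.1), sub_pos.2 hx, fun y hy => ?_⟩
  have := P.dist_triangle y x (P.seq n.1)
  change P.dist y (P.seq n.1) < _
  linarith

lemma ball_subset_cball (n : ℕ × ℕ) : P.ball n ⊆ P.cball n :=
  fun x hx => (show P.dist x _ < _ from hx).le

variable {P}

lemma prec.ball_subset {n m : ℕ × ℕ} (h : P.prec n m) : P.ball m ⊆ P.ball n :=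
  (P.ball_subset_cball m).trans h.2

lemma prec.trans {n m k : ℕ × ℕ} (h : P.prec n m) (h' : P.prec m k) : P.prec n k :=
  ⟨h.1.trans h'.1, h'.2.trans h.ball_subset⟩

/-- A ball of small radius around a point of `B_P(n)` is `≺_P`-above `n`. -/
lemma prec_of_small {n m : ℕ × ℕ} {x : X} (hx : x ∈ P.ball m) (hlt : n.2 < m.2)
    (hm : (1/2 : ℝ) ^ m.2 ≤ (1/2 : ℝ) ^ (n.2 + 1) - P.dist x (P.seq n.1)) : P.prec n m := by
  refine ⟨hlt, fun y hy => ?_⟩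
  have h₁ := P.dist_triangle y (P.seq m.1) (P.seq n.1)
  have h₂ := P.dist_triangle (P.seq m.1) x (P.seq n.1)
  rw [P.dist_comm (P.seq m.1) x] at h₂
  change P.dist x (P.seq m.1) < _ at hx
  change P.dist y (P.seq m.1) ≤ _ at hy
  change P.dist y (P.seq n.1) < _
  rw [pow_succ] at hx hy
  linarith

lemma exists_forall_half_pow_lt {ε : ℝ} (hε : 0 < ε) : ∃ N : ℕ, ∀ k ≥ N, (1/2 : ℝ) ^ k < ε := by
  obtain ⟨N, hN⟩ := exists_pow_lt_of_lt_one hε (by norm_num : (1/2 : ℝ) < 1)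
  exact ⟨N, fun k hk =>
    (pow_le_pow_of_le_one (by norm_num) (by norm_num) hk).trans_lt hN⟩

lemma exists_prec {n : ℕ × ℕ} {x : X} (hx : x ∈ P.ball n) {ε : ℝ} (hε : 0 < ε) :
    ∃ m, P.prec n m ∧ x ∈ P.ball m ∧ (1/2 : ℝ) ^ m.2 < ε := by
  obtain ⟨N, hN⟩ := exists_forall_half_pow_lt (sub_pos.2 hx)
  obtain ⟨M, hM⟩ := exists_forall_half_pow_lt hε
  set k := max (max N M) (n.2 + 1) with hk
  obtain ⟨i, hi⟩ := P.dense x ((1/2 : ℝ) ^ (k + 1)) (by positivity)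
  have hxm : x ∈ P.ball (i, k) := hi
  exact ⟨(i, k), prec_of_small hxm (by grind) (hN k (by grind)).le, hxm, hM k (by grind)⟩

lemma exists_mem_ball_subset {U : Set X} (hU : IsOpen U) {x : X} (hx : x ∈ U) :
    ∃ n, x ∈ P.ball n ∧ P.ball n ⊆ U := by
  obtain ⟨ε, hε, h⟩ := (P.isOpen_iff U).1 hU x hx
  obtain ⟨k, hk⟩ := exists_forall_half_pow_lt hε
  obtain ⟨i, hi⟩ := P.dense x ((1/2 : ℝ) ^ (k + 1)) (by positivity)
  refine ⟨(i, k), hi, fun y hy => h y ?_⟩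
  have h₁ := P.dist_triangle y (P.seq i) x
  rw [P.dist_comm (P.seq i) x] at h₁
  change P.dist y (P.seq i) < (1/2 : ℝ) ^ (k + 1) at hy
  have := hk k le_rfl
  rw [pow_succ] at hi hy
  linarith

lemma prec_of_lt {f : ℕ → ℕ × ℕ} (hf : ∀ i, P.prec (f i) (f (i + 1))) {i j : ℕ} (hij : i < j) :
    P.prec (f i) (f j) := by
  induction j, hij using Nat.le_induction with
  | base => exact hf i
  | succ j _ ih => exact ih.trans (hf j)

lemma le_snd {f : ℕ → ℕ × ℕ} (hf : ∀ i, P.prec (f i) (f (i + 1))) (i : ℕ) : i ≤ (f i).2 :=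
  (strictMono_nat_of_lt_succ fun i => (hf i).1 : StrictMono fun i => (f i).2).le_apply

/-- By completeness, every `P`-compatible sequence determines a point. -/
lemma exists_mem_ball {f : ℕ → ℕ × ℕ} (hf : ∀ i, P.prec (f i) (f (i + 1))) :
    ∃ x, ∀ i, x ∈ P.ball (f i) := by
  have hmem : ∀ i, ∀ j ≥ i, P.dist (P.seq (f j).1) (P.seq (f i).1) < (1/2 : ℝ) ^ ((f i).2 + 1) := by
    intro i j hij
    have hself : P.seq (f j).1 ∈ P.ball (f j) := by
      change P.dist _ _ < _
      rw [P.dist_self]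
      positivity
    rcases hij.eq_or_lt with rfl | h
    · exact hself
    · exact (prec_of_lt hf h).ball_subset hself
  obtain ⟨x, hx⟩ := P.complete (fun i => P.seq (f i).1) (by
    intro ε hε
    obtain ⟨N, hN⟩ := exists_forall_half_pow_lt hε
    refine ⟨N, fun m hm n hn => ?_⟩
    have h₁ := hmem N m hm
    have h₂ := hmem N n hn
    have h₃ := P.dist_triangle (P.seq (f m).1) (P.seq (f N).1) (P.seq (f n).1)
    rw [P.dist_comm (P.seq (f N).1)] at h₃
    have h₄ := hN _ (le_snd hf N)
    rw [pow_succ] at h₁ h₂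
    linarith)
  refine ⟨x, fun i => (hf i).2 ?_⟩
  change P.dist x _ ≤ _
  refine le_of_forall_pos_lt_add fun ε hε => ?_
  obtain ⟨N, hN⟩ := hx ε hε
  have h₁ := hN (max N (i + 1)) (le_max_left _ _)
  have h₂ := hmem (i + 1) (max N (i + 1)) (le_max_right _ _)
  have h₃ := P.dist_triangle x (P.seq (f (max N (i + 1))).1) (P.seq (f (i + 1)).1)
  rw [P.dist_comm x (P.seq (f (max N (i + 1))).1)] at h₃
  linarith

/-- An invariant preserved by a choice of `≺_P`-successors yields a `P`-compatible sequence. -/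
lemma exists_seq {Q : ℕ × ℕ → Prop} (hQ : ∀ n, Q n → ∃ m, Q m ∧ P.prec n m)
    {n : ℕ × ℕ} (hn : Q n) :
    ∃ f : ℕ → ℕ × ℕ, f 0 = n ∧ (∀ i, P.prec (f i) (f (i + 1))) ∧ ∀ i, Q (f i) := by
  choose g hg hprec using hQ
  let F : ℕ → {n // Q n} := fun i => Nat.rec ⟨n, hn⟩ (fun _ m => ⟨g m.1 m.2, hg m.1 m.2⟩) i
  exact ⟨fun i => (F i).1, rfl, fun i => hprec (F i).1 (F i).2, fun i => (F i).2⟩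

section LimitSet

variable {A : Set (ℕ × ℕ)}

lemma mem_limitSet_iff (hA : P.PClosed A) {x : X} :
    x ∈ P.limitSet A ↔ ∀ n, x ∈ P.ball n → n ∈ A := by
  constructor
  · rintro ⟨f, ⟨hf, hfA⟩, hx⟩ n hn
    obtain ⟨N, hN⟩ := exists_forall_half_pow_lt (sub_pos.2 hn)
    have hi := le_snd hf (max N (n.2 + 1))
    exact hA _ (hfA (max N (n.2 + 1))) _
      (prec_of_small (hx _) (by grind) (hN _ (by grind)).le)
  · intro h
    obtain ⟨n, hn, -⟩ := exists_mem_ball_subset (P := P) isOpen_univ (mem_univ x)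
    obtain ⟨f, -, hf, hfx⟩ := exists_seq (P := P) (Q := fun n => x ∈ P.ball n)
      (fun n hn => by
        obtain ⟨m, hm, hxm, -⟩ := exists_prec hn one_pos
        exact ⟨m, hxm, hm⟩) hn
    exact ⟨f, ⟨hf, fun i => h _ (hfx i)⟩, hfx⟩

lemma isClosed_limitSet (hA : P.PClosed A) : IsClosed (P.limitSet A) := by
  have : P.limitSet A = ⋂ n ∈ Aᶜ, (P.ball n)ᶜ := by
    ext x
    simp only [mem_limitSet_iff hA, mem_iInter, mem_compl_iff]
    exact forall_congr' fun n => by tauto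
  rw [this]
  exact isClosed_biInter fun n _ => (P.isOpen_ball n).isClosed_compl

lemma ball_inter_limitSet_nonempty (hA : P.PPerfect A) {n : ℕ × ℕ} (hn : n ∈ A) :
    (P.ball n ∩ P.limitSet A).Nonempty := by
  obtain ⟨f, hf₀, hf, hfA⟩ := exists_seq (P := P) (Q := fun n => n ∈ A)
    (fun n hn => by
      obtain ⟨u, hu, _, _, hnu, _⟩ := hA n hn
      exact ⟨u, hu, hnu⟩) hn
  obtain ⟨x, hx⟩ := exists_mem_ball hf
  exact ⟨x, hf₀ ▸ hx 0, f, ⟨hf, hfA⟩, hx⟩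

lemma perfect_limitSet (hA : P.PClosed A) (hA' : P.PPerfect A) : Perfect (P.limitSet A) := by
  refine ⟨isClosed_limitSet hA, fun x hx => accPt_iff_nhds.2 fun U hU => ?_⟩
  obtain ⟨V, hVU, hV, hxV⟩ := mem_nhds_iff.1 hU
  obtain ⟨n, hxn, hnV⟩ := exists_mem_ball_subset (P := P) hV hxV
  obtain ⟨u, hu, v, hv, hnu, hnv, huv⟩ := hA' n ((mem_limitSet_iff hA).1 hx n hxn)
  obtain ⟨y, hyu, hy⟩ := ball_inter_limitSet_nonempty hA' hu
  obtain ⟨z, hzv, hz⟩ := ball_inter_limitSet_nonempty hA' hv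
  by_cases hyx : y = x
  · refine ⟨z, ⟨hVU (hnV (hnv.ball_subset hzv)), hz⟩, fun hzx => ?_⟩
    rw [hyx] at hyu
    rw [hzx] at hzv
    exact eq_empty_iff_forall_notMem.1 huv x
      ⟨P.ball_subset_cball u hyu, P.ball_subset_cball v hzv⟩
  · exact ⟨y, ⟨hVU (hnV (hnu.ball_subset hyu)), hy⟩, hyx⟩

lemma limitSet_subset {F : Set X} (hF : IsClosed F) (hA : P.PClosed A) (hAF : A ⊆ P.code F) :
    P.limitSet A ⊆ F := by
  intro x hx
  by_contra hxF
  obtain ⟨n, hxn, hn⟩ := exists_mem_ball_subset (P := P) hF.isOpen_compl hxF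
  obtain ⟨y, hyn, hyF⟩ := hAF ((mem_limitSet_iff hA).1 hx n hxn)
  exact hn hyn hyF

end LimitSet

variable (P)

lemma pClosed_code (F : Set X) : P.PClosed (P.code F) :=
  fun _ ⟨x, hx, hxF⟩ _ h => ⟨x, h.ball_subset hx, hxF⟩

lemma pPerfect_code {K : Set X} (hK : Preperfect K) : P.PPerfect (P.code K) := by
  rintro n ⟨x, hxn, hxK⟩
  obtain ⟨y, ⟨hyn, hyK⟩, hyx⟩ :=
    accPt_iff_nhds.1 (hK x hxK) _ ((P.isOpen_ball n).mem_nhds hxn)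
  have hpos : 0 < P.dist x y := (P.dist_nonneg x y).lt_of_ne'
    fun h => hyx (P.eq_of_dist_eq_zero x y h).symm
  obtain ⟨u, hnu, hxu, hu⟩ := exists_prec hxn (half_pos hpos)
  obtain ⟨v, hnv, hyv, hv⟩ := exists_prec hyn (half_pos hpos)
  refine ⟨u, ⟨x, hxu, hxK⟩, v, ⟨y, hyv, hyK⟩, hnu, hnv, eq_empty_iff_forall_notMem.2 ?_⟩
  rintro z ⟨hzu, hzv⟩
  change P.dist _ _ < _ at hxu hyv
  change P.dist _ _ ≤ _ at hzu hzv
  have h₁ := P.dist_triangle x (P.seq u.1) y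
  have h₂ := P.dist_triangle (P.seq u.1) z y
  have h₃ := P.dist_triangle z (P.seq v.1) y
  rw [P.dist_comm (P.seq u.1) z] at h₂
  rw [P.dist_comm (P.seq v.1) y] at h₃
  rw [pow_succ] at hxu hyv hzu hzv
  linarith

lemma deriv_subset (A : Set (ℕ × ℕ)) : P.deriv A ⊆ A := fun _ h => h.1

variable {P} in
lemma PClosed.deriv {A : Set (ℕ × ℕ)} (hA : P.PClosed A) : P.PClosed (P.deriv A) := by
  rintro n ⟨hn, u, hu, v, hv, hnu, hnv, huv⟩ m hmn
  exact ⟨hA n hn m hmn, u, hu, v, hv, hmn.trans hnu, hmn.trans hnv, huv⟩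

variable {P} in
lemma PPerfect.subset_deriv {A B : Set (ℕ × ℕ)} (hA : P.PPerfect A) (hAB : A ⊆ B) :
    A ⊆ P.deriv B := by
  intro n hn
  obtain ⟨u, hu, v, hv, h⟩ := hA n hn
  exact ⟨hAB hn, u, hAB hu, v, hAB hv, h⟩

section Iterates

variable (A : Set (ℕ × ℕ))

lemma derivIter_zero : P.derivIter A 0 = A := Ordinal.limitRecOn_zero ..

lemma derivIter_add_one (α : Ordinal.{0}) :
    P.derivIter A (α + 1) = P.deriv (P.derivIter A α) := Ordinal.limitRecOn_add_one ..

lemma derivIter_limit {α : Ordinal.{0}} (hα : Order.IsSuccLimit α) :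
    P.derivIter A α = ⋂ β : {β : Ordinal.{0} // β < α}, P.derivIter A β :=
  Ordinal.limitRecOn_limit _ _ _ _ hα

lemma derivIter_antitone : Antitone (P.derivIter A) := by
  intro α β hαβ
  induction β using Ordinal.limitRecOn with
  | zero => rw [le_antisymm hαβ zero_le]
  | add_one β ih =>
    rcases hαβ.eq_or_lt with rfl | h
    · exact le_rfl
    · rw [derivIter_add_one]
      exact (P.deriv_subset _).trans (ih (Order.lt_add_one_iff.1 h))
  | limit β hβ _ =>
    rcases hαβ.eq_or_lt with rfl | h
    · exact le_rfl
    · rw [P.derivIter_limit A hβ]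
      exact iInter_subset (fun γ : {γ : Ordinal.{0} // γ < β} => P.derivIter A γ) ⟨α, h⟩

lemma deriv_derivIter_rankA :
    P.deriv (P.derivIter A (P.rankA A)) = P.derivIter A (P.rankA A) := by
  rw [← derivIter_add_one]
  refine csInf_mem (s := {α | P.derivIter A (α + 1) = P.derivIter A α}) ?_
  by_contra hne
  have hne' : ∀ α, P.derivIter A (α + 1) ≠ P.derivIter A α := fun α hα => hne ⟨α, hα⟩
  refine not_injective_of_ordinal (P.derivIter A) (StrictAnti.injective fun α β hαβ => ?_)
  exact (P.derivIter_antitone A (Order.add_one_le_of_lt hαβ)).trans_lt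
    ((P.derivIter_antitone A (le_add_of_nonneg_right zero_le)).lt_of_ne (hne' α))

variable {P A}

lemma pPerfect_derivIter_rankA : P.PPerfect (P.derivIter A (P.rankA A)) := by
  intro n hn
  rw [← deriv_derivIter_rankA] at hn
  exact hn.2

lemma PClosed.derivIter (hA : P.PClosed A) (α : Ordinal.{0}) : P.PClosed (P.derivIter A α) := by
  induction α using Ordinal.limitRecOn with
  | zero => rwa [derivIter_zero]
  | add_one α ih =>
    rw [derivIter_add_one]
    exact ih.deriv
  | limit α hα ih =>
    rw [P.derivIter_limit A hα]
    intro n hn m hmn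
    exact mem_iInter.2 fun β => ih β.1 β.2 n (mem_iInter.1 hn β) m hmn

lemma PPerfect.subset_derivIter {B : Set (ℕ × ℕ)} (hB : P.PPerfect B) (hBA : B ⊆ A)
    (α : Ordinal.{0}) : B ⊆ P.derivIter A α := by
  induction α using Ordinal.limitRecOn with
  | zero => rwa [derivIter_zero]
  | add_one α ih =>
    rw [derivIter_add_one]
    exact hB.subset_deriv ih
  | limit α hα ih =>
    rw [P.derivIter_limit A hα]
    exact subset_iInter fun β => ih β.1 β.2

end Iterates

end Presentation

lemma Perfect.not_countable {X : Type*} [TopologicalSpace X] [PolishSpace X] {C : Set X}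
    (hC : Perfect C) (hne : C.Nonempty) : ¬ C.Countable := by
  let _ := TopologicalSpace.upgradeIsCompletelyMetrizable X
  obtain ⟨f, hfC, -, hf⟩ := hC.exists_nat_bool_injection hne
  intro hcount
  have h : (f ⁻¹' range f).Countable := (hcount.mono hfC).preimage hf
  rw [preimage_range, countable_univ_iff] at h
  refine (Cardinal.mk_le_aleph0_iff.2 h).not_gt ?_
  simpa only [Cardinal.mk_pi, Cardinal.prod_const, Cardinal.mk_nat, Cardinal.mk_bool,
    Cardinal.lift_id] using Cardinal.cantor Cardinal.aleph0

/-- `π_P([D_P^{|A_F^P|_P}(A_F^P)]_P)` is the perfect kernel of `F`, i.e. the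
largest perfect subset of `F`; in particular `F` is countable iff
`[D_P^{|A_F^P|_P}(A_F^P)]_P = ∅`. -/
theorem stmt5 {X : Type} [TopologicalSpace X] [PolishSpace X] (P : Presentation X)
    (F : Set X) (hF : IsClosed F) :
    Perfect (P.limitSet (P.derivIter (P.code F) (P.rankA (P.code F)))) ∧
    P.limitSet (P.derivIter (P.code F) (P.rankA (P.code F))) ⊆ F ∧
    (∀ K : Set X, Perfect K → K ⊆ F →
      K ⊆ P.limitSet (P.derivIter (P.code F) (P.rankA (P.code F)))) ∧
    (F.Countable ↔ P.body (P.derivIter (P.code F) (P.rankA (P.code F))) = ∅) := by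
  have hclosed := (P.pClosed_code F).derivIter (P.rankA (P.code F))
  have hperf : P.PPerfect (P.derivIter (P.code F) (P.rankA (P.code F))) :=
    Presentation.pPerfect_derivIter_rankA
  have hsub : P.derivIter (P.code F) (P.rankA (P.code F)) ⊆ P.code F := by
    simpa only [Presentation.derivIter_zero] using
      P.derivIter_antitone (P.code F) (zero_le (a := P.rankA (P.code F)))
  have hL := Presentation.perfect_limitSet hclosed hperf
  have hLF := Presentation.limitSet_subset hF hclosed hsub
  have hmax : ∀ K : Set X, Perfect K → K ⊆ F →
      K ⊆ P.limitSet (P.derivIter (P.code F) (P.rankA (P.code F))) := by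
    intro K hK hKF x hx
    refine (Presentation.mem_limitSet_iff hclosed).2 fun n hn => ?_
    refine (P.pPerfect_code hK.acc).subset_derivIter ?_ _ ⟨x, hn, hx⟩
    exact fun m hm => hm.mono (inter_subset_inter_right _ hKF)
  refine ⟨hL, hLF, hmax, fun hcount => ?_, fun hempty => ?_⟩
  · refine eq_empty_iff_forall_notMem.2 fun f hf => ?_
    obtain ⟨x, hx⟩ := Presentation.exists_mem_ball hf.1
    exact hL.not_countable ⟨x, f, hf, hx⟩ (hcount.mono hLF)
  · by_contra hcount
    obtain ⟨K, hK, ⟨x, hx⟩, hKF⟩ := exists_perfect_nonempty_of_isClosed_of_not_countable hF hcount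
    obtain ⟨f, hf, -⟩ := hmax K hK hKF hx
    exact notMem_empty f (hempty ▸ hf)
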